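/- Let Ω ⊂ ℂ be a nonempty bounded simply connected open set. Let f : ℂ ∖ Ω → ℂ be continuous, holomorphic on ℂ ∖ closure(Ω), with f(z) = i·Im(z) for every z ∈ ∂Ω, and suppose there exist complex numbers α ≠ 0 and β such that f(z) - (αz + β) → 0 as |z| → ∞. Set c₁ = inf{Im(z) : z ∈ ∂Ω} and c₂ = sup{Im(z) : z ∈ ∂Ω}. Then the image of ℂ ∖ closure(Ω) under f equals ℂ ∖ {i·t : t ∈ ℝ, c₁ ≤ t ≤ c₂}. -/

import Mathlib

open Filter

open Topology Set in
/-- A subset of `ℂ` all of whose points are isolated in it is countable. -/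
lemma countable_of_eventually_notMem {D : Set ℂ} (h : ∀ z ∈ D, ∀ᶠ y in 𝓝[≠] z, y ∉ D) :
    D.Countable := by
  refine (HereditarilyLindelofSpace.isLindelof D).countable_of_isDiscrete
    (isDiscrete_iff_nhdsNE.2 fun z hz => ?_)
  rw [← disjoint_iff, Filter.disjoint_principal_right]
  exact h z hz

open Set in
/-- On a bounded open set, the imaginary part is exceeded, in either vertical direction, at some
point of the closure lying outside the set. -/
lemma exists_mem_closure_diff_lt_mul_im {V : Set ℂ} (hV : IsOpen V)
    (hb : Bornology.IsBounded V) {z : ℂ} (hz : z ∈ V) {s : ℝ} (hs : s ≠ 0) :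
    ∃ p ∈ closure V, p ∉ V ∧ s * z.im < s * p.im := by
  have push : ∀ q ∈ V, ∃ y ∈ V, s * q.im < s * y.im := by
    intro q hq
    have hc : Tendsto (fun t : ℝ => q + (t * s : ℝ) * Complex.I) (nhdsWithin 0 (Ioi 0))
        (nhds q) := by
      have : Continuous (fun t : ℝ => q + (t * s : ℝ) * Complex.I) := by fun_prop
      have h := this.tendsto 0
      simp only [zero_mul, Complex.ofReal_zero, add_zero] at h
      exact h.mono_left nhdsWithin_le_nhds
    obtain ⟨t, ht, htpos⟩ :=
      ((hc.eventually (hV.mem_nhds hq)).and self_mem_nhdsWithin).exists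
    refine ⟨_, ht, ?_⟩
    have : 0 < t * (s * s) := mul_pos htpos (mul_self_pos.2 hs)
    simp
    nlinarith
  obtain ⟨p, hp, hmax⟩ := hb.isCompact_closure.exists_isMaxOn ⟨z, subset_closure hz⟩
    (f := fun y : ℂ => s * y.im) (by fun_prop)
  refine ⟨p, hp, fun hpV => ?_, ?_⟩
  · obtain ⟨y, hy, hlt⟩ := push p hpV
    exact absurd (hmax (subset_closure hy)) (not_le.2 hlt)
  · obtain ⟨y, hy, hlt⟩ := push z hz
    exact hlt.trans_le (hmax (subset_closure hy))

/-- A point of an open set that is adherent to one of its components belongs to it. -/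
lemma mem_connectedComponentIn_of_mem_closure {U : Set ℂ} {z p : ℂ} (hz : z ∈ U) (hp : p ∈ U)
    (hpc : p ∈ closure (connectedComponentIn U z)) : p ∈ connectedComponentIn U z := by
  have hpre : IsPreconnected (insert p (connectedComponentIn U z)) :=
    isPreconnected_connectedComponentIn.subset_closure (Set.subset_insert _ _)
      (Set.insert_subset hpc subset_closure)
  exact hpre.subset_connectedComponentIn
    (Set.mem_insert_of_mem _ (mem_connectedComponentIn hz))
    (Set.insert_subset hp (connectedComponentIn_subset _ _)) (Set.mem_insert _ _)

open Topology in
/-- A holomorphic function tending to infinity at infinity, with the imaginary part as its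
imaginary part on the boundary, is nowhere locally constant. -/
lemma not_eventually_const_of_im_eq {f : ℂ → ℂ} {E U : Set ℂ} (hE : IsClosed E) (hU : IsOpen U)
    (hUE : U ⊆ E) (hcont : ContinuousOn f E) (hhol : DifferentiableOn ℂ f U)
    (hinf : Tendsto (fun z => ‖f z‖) (cocompact ℂ) atTop)
    (him : ∀ z ∈ E, z ∉ U → (f z).im = z.im) {z : ℂ} (hz : z ∈ U) :
    ¬ ∀ᶠ y in 𝓝 z, f y = f z := by
  intro hev
  set V := connectedComponentIn U z with hVdef
  have hVU : V ⊆ U := connectedComponentIn_subset _ _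
  have hVo : IsOpen V := hU.connectedComponentIn
  have hzV : z ∈ V := mem_connectedComponentIn hz
  have hfV : Set.EqOn f (fun _ => f z) V :=
    AnalyticOnNhd.eqOn_of_preconnected_of_eventuallyEq
      ((hhol.mono hVU).analyticOnNhd hVo) analyticOnNhd_const
      isPreconnected_connectedComponentIn hzV hev
  have hVb : Bornology.IsBounded V := by
    rw [Bornology.isBounded_def, Metric.cobounded_eq_cocompact]
    filter_upwards [hinf.eventually (eventually_gt_atTop ‖f z‖)] with y hy hyV
    rw [hfV hyV] at hy
    exact lt_irrefl _ hy
  have hclE : closure V ⊆ E := hE.closure_subset_iff.2 (hVU.trans hUE)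
  have hfcl : Set.EqOn f (fun _ => f z) (closure V) :=
    hfV.of_subset_closure (hcont.mono hclE) continuousOn_const subset_closure subset_rfl
  have key : ∀ s : ℝ, s ≠ 0 → s * z.im < s * (f z).im := by
    intro s hs
    obtain ⟨p, hp, hpV, hlt⟩ := exists_mem_closure_diff_lt_mul_im hVo hVb hzV hs
    have hpU : p ∉ U := fun h => hpV (mem_connectedComponentIn_of_mem_closure hz h hp)
    have := him p (hclE hp) hpU
    rw [hfcl hp] at this
    rwa [this]
  have h1 := key 1 (by norm_num)
  have h2 := key (-1) (by norm_num)
  linarith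

open Topology in
/-- The critical points of a holomorphic function that is nowhere locally constant are countable. -/
lemma countable_setOf_deriv_eq_zero {f : ℂ → ℂ} {U : Set ℂ} (hU : IsOpen U)
    (hhol : DifferentiableOn ℂ f U) (hnc : ∀ z ∈ U, ¬ ∀ᶠ y in 𝓝 z, f y = f z) :
    {z ∈ U | deriv f z = 0}.Countable := by
  refine countable_of_eventually_notMem fun z hz => ?_
  have han : AnalyticAt ℂ (deriv f) z := (hhol.analyticAt (hU.mem_nhds hz.1)).deriv
  rcases han.eventually_eq_zero_or_eventually_ne_zero with h | h
  · exfalso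
    obtain ⟨r, hr, hball⟩ := Metric.eventually_nhds_iff_ball.1 (h.and (hU.mem_nhds hz.1))
    refine hnc z hz.1 ?_
    filter_upwards [Metric.ball_mem_nhds z hr] with y hy
    exact Metric.isOpen_ball.is_const_of_deriv_eq_zero Metric.isPreconnected_ball
      (hhol.mono fun x hx => (hball x hx).2) (fun x hx => (hball x hx).1) hy
      (Metric.mem_ball_self hr)
  · filter_upwards [h] with y hy hyD using hy hyD.2

/-- A function asymptotic to a nonconstant affine map tends to infinity at infinity. -/
lemma tendsto_norm_atTop_of_tendsto_sub_affine {f : ℂ → ℂ} {α β : ℂ} (hα : α ≠ 0)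
    (hasym : Tendsto (fun z => f z - (α * z + β)) (cocompact ℂ) (nhds 0)) :
    Tendsto (fun z => ‖f z‖) (cocompact ℂ) atTop := by
  have h1 : Tendsto (fun z : ℂ => ‖α‖ * ‖z‖) (cocompact ℂ) atTop :=
    (tendsto_norm_cocompact_atTop (E := ℂ)).const_mul_atTop (norm_pos_iff.2 hα)
  have h2 : Tendsto (fun z : ℂ => ‖α‖ * ‖z‖ + (-(‖β‖ + 1))) (cocompact ℂ) atTop :=
    tendsto_atTop_add_const_right _ _ h1
  refine tendsto_atTop_mono' _ ?_ h2
  filter_upwards [hasym.norm.eventually (gt_mem_nhds (show ‖(0 : ℂ)‖ < 1 by simp))] with z hz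
  have e : α * z = f z - (f z - (α * z + β)) - β := by ring
  have h3 := norm_sub_le (f z - (f z - (α * z + β))) β
  have h4 := norm_sub_le (f z) (f z - (α * z + β))
  rw [← e, norm_mul] at h3
  linarith

/-- Preimages of convergent sequences under a continuous function on a closed set tending to
infinity at infinity subconverge. -/
lemma exists_subseq_tendsto_of_tendsto_comp {f : ℂ → ℂ} {E : Set ℂ} (hE : IsClosed E)
    (hcont : ContinuousOn f E) (hinf : Tendsto (fun z => ‖f z‖) (cocompact ℂ) atTop)
    {u : ℕ → ℂ} (hu : ∀ n, u n ∈ E) {w : ℂ} (hw : Tendsto (fun n => f (u n)) atTop (nhds w)) :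
    ∃ z ∈ E, f z = w ∧ ∃ φ : ℕ → ℕ, StrictMono φ ∧ Tendsto (u ∘ φ) atTop (nhds z) := by
  obtain ⟨M, hM⟩ := (Metric.isBounded_range_of_tendsto _ hw).exists_norm_le
  have hb : Bornology.IsBounded {z : ℂ | ‖f z‖ ≤ M} := by
    rw [Bornology.isBounded_def, Metric.cobounded_eq_cocompact]
    filter_upwards [hinf.eventually (eventually_gt_atTop M)] with y hy hyV
    exact absurd hyV (not_le.2 hy)
  obtain ⟨z, -, φ, hφ, hlim⟩ := tendsto_subseq_of_bounded hb
    (x := u) fun n => hM _ ⟨n, rfl⟩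
  have hzE : z ∈ E := hE.mem_of_tendsto hlim (Eventually.of_forall fun n => hu _)
  refine ⟨z, hzE, ?_, φ, hφ, hlim⟩
  have h1 : Tendsto (fun n => f ((u ∘ φ) n)) atTop (nhds (f z)) :=
    (hcont z hzE).tendsto.comp
      (tendsto_nhdsWithin_iff.2 ⟨hlim, Eventually.of_forall fun n => hu _⟩)
  exact tendsto_nhds_unique h1 (hw.comp hφ.tendsto_atTop)

/-- A continuous function on a closed set tending to infinity at infinity has closed image. -/
lemma isClosed_image_of_tendsto_norm_atTop {f : ℂ → ℂ} {E : Set ℂ} (hE : IsClosed E)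
    (hcont : ContinuousOn f E) (hinf : Tendsto (fun z => ‖f z‖) (cocompact ℂ) atTop) :
    IsClosed (f '' E) := by
  refine isClosed_of_closure_subset fun w hw => ?_
  obtain ⟨x, hx, hlim⟩ := mem_closure_iff_seq_limit.1 hw
  choose u hu hfu using hx
  obtain ⟨z, hz, hfz, -⟩ := exists_subseq_tendsto_of_tendsto_comp hE hcont hinf hu
    (w := w) (by simpa only [hfu] using hlim)
  exact ⟨z, hz, hfz⟩

/-- A holomorphic function asymptotic to a nonconstant affine map takes values of large modulus
at most once. -/
lemma exists_injective_of_lt_norm {f : ℂ → ℂ} {E U : Set ℂ} (hE : IsClosed E)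
    (hcont : ContinuousOn f E) (hhol : DifferentiableOn ℂ f U) (hUb : Bornology.IsBounded Uᶜ)
    {α β : ℂ} (hα : α ≠ 0)
    (hasym : Tendsto (fun z => f z - (α * z + β)) (cocompact ℂ) (nhds 0)) :
    ∃ M : ℝ, ∀ z₁ ∈ E, ∀ z₂ ∈ E, f z₁ = f z₂ → M < ‖f z₁‖ → z₁ = z₂ := by
  set g : ℂ → ℂ := fun z => f z - (α * z + β) with hg
  have hαpos : 0 < ‖α‖ := norm_pos_iff.2 hα
  have hsmall : ∀ᶠ z in cocompact ℂ, ‖g z‖ < ‖α‖ / 4 ∧ z ∈ U := by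
    refine (hasym.norm.eventually (gt_mem_nhds ?_)).and ?_
    · simpa using hαpos
    · rw [← Metric.cobounded_eq_cocompact]
      simpa using Bornology.isBounded_def.1 hUb
  rw [← Metric.cobounded_eq_cocompact] at hsmall
  obtain ⟨R, -, hR⟩ := (Filter.hasBasis_cobounded_norm (E := ℂ)).eventually_iff.1 hsmall
  obtain ⟨M, hM⟩ := ((isCompact_closedBall (0 : ℂ) (R + 1)).inter_left hE).exists_bound_of_continuousOn
    (hcont.mono Set.inter_subset_left)
  have hlarge : ∀ z ∈ E, M < ‖f z‖ → R + 1 < ‖z‖ := by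
    intro z hz hlt
    by_contra! hle
    exact absurd (hM z ⟨hz, by simpa using hle⟩) (not_le.2 hlt)
  refine ⟨M, fun z₁ hz₁ z₂ hz₂ heq hlt => ?_⟩
  have hR₁ := hlarge z₁ hz₁ hlt
  have hR₂ := hlarge z₂ hz₂ (heq ▸ hlt)
  have hball : ∀ y ∈ Metric.ball z₁ 1, ‖g y‖ < ‖α‖ / 4 ∧ y ∈ U := by
    intro y hy
    refine hR ?_
    have h1 := norm_le_norm_add_norm_sub' z₁ y
    rw [mem_ball_iff_norm, norm_sub_rev] at hy
    simp only [Set.mem_ofPred_eq]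
    linarith
  have hg₁ := (hball z₁ (Metric.mem_ball_self one_pos)).1
  have hg₂ : ‖g z₂‖ < ‖α‖ / 4 := (hR (by simp only [Set.mem_ofPred_eq]; linarith)).1
  have hdist : dist (g z₂) (g z₁) = ‖α‖ * dist z₂ z₁ := by
    rw [dist_eq_norm, dist_eq_norm, ← norm_mul, ← norm_neg]
    congr 1
    simp only [hg, heq]
    ring
  have hmaps : Set.MapsTo g (Metric.ball z₁ 1) (Metric.closedBall (g z₁) (‖α‖ / 2)) := by
    intro y hy
    have h1 := norm_sub_le (g y) (g z₁)
    have h2 := (hball y hy).1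
    rw [mem_closedBall_iff_norm]
    linarith
  have hlt1 : dist z₂ z₁ < 1 := by
    have h1 := norm_sub_le (g z₂) (g z₁)
    rw [← dist_eq_norm, hdist] at h1
    nlinarith
  have hgd : DifferentiableOn ℂ g (Metric.ball z₁ 1) :=
    (hhol.mono fun y hy => (hball y hy).2).sub (by fun_prop)
  have hschwarz := Complex.dist_le_div_mul_dist_of_mapsTo_ball hgd hmaps hlt1
  rw [hdist] at hschwarz
  have : dist z₂ z₁ = 0 := le_antisymm (by nlinarith) dist_nonneg
  exact (dist_eq_zero.1 this).symm

open Topology in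
/-- The set of values with nonzero real part taken at least twice by an open map is open. -/
lemma isOpen_setOf_double_value {f : ℂ → ℂ} {U : Set ℂ} (hU : IsOpen U)
    (hopen : ∀ z ∈ U, 𝓝 (f z) ≤ map f (𝓝 z)) :
    IsOpen {w : ℂ | w.re ≠ 0 ∧ ∃ z₁ ∈ U, ∃ z₂ ∈ U, z₁ ≠ z₂ ∧ f z₁ = w ∧ f z₂ = w} := by
  rw [isOpen_iff_mem_nhds]
  rintro w ⟨hw, z₁, hz₁, z₂, hz₂, hne, h₁, h₂⟩
  obtain ⟨N₁, hN₁, N₂, hN₂, hdisj⟩ := Filter.disjoint_iff.1 (disjoint_nhds_nhds.2 hne)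
  have i₁ : f '' (N₁ ∩ U) ∈ 𝓝 w :=
    h₁ ▸ hopen z₁ hz₁ (image_mem_map (inter_mem hN₁ (hU.mem_nhds hz₁)))
  have i₂ : f '' (N₂ ∩ U) ∈ 𝓝 w :=
    h₂ ▸ hopen z₂ hz₂ (image_mem_map (inter_mem hN₂ (hU.mem_nhds hz₂)))
  have hre : ∀ᶠ v : ℂ in 𝓝 w, v.re ≠ 0 :=
    Complex.continuous_re.continuousAt.eventually_ne hw
  filter_upwards [i₁, i₂, hre] with v hv₁ hv₂ hv
  obtain ⟨y₁, ⟨hy₁, hy₁U⟩, e₁⟩ := hv₁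
  obtain ⟨y₂, ⟨hy₂, hy₂U⟩, e₂⟩ := hv₂
  refine ⟨hv, y₁, hy₁U, y₂, hy₂U, ?_, e₁, e₂⟩
  rintro rfl
  exact Set.disjoint_left.1 hdisj hy₁ hy₂

open Topology in
/-- A limit, with nonzero real part, of values taken at least twice is a critical value or is
itself taken at least twice. -/
lemma exists_double_value_of_mem_closure {f : ℂ → ℂ} {E U : Set ℂ} (hE : IsClosed E)
    (hU : IsOpen U) (hUE : U ⊆ E) (hcont : ContinuousOn f E) (hhol : DifferentiableOn ℂ f U)
    (hinf : Tendsto (fun z => ‖f z‖) (cocompact ℂ) atTop)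
    (hre : ∀ z ∈ E, z ∉ U → (f z).re = 0) {w : ℂ} (hw : w.re ≠ 0)
    (hcl : w ∈ closure
      {w : ℂ | w.re ≠ 0 ∧ ∃ z₁ ∈ U, ∃ z₂ ∈ U, z₁ ≠ z₂ ∧ f z₁ = w ∧ f z₂ = w})
    (hcrit : w ∉ f '' {z ∈ U | deriv f z = 0}) :
    ∃ z₁ ∈ U, ∃ z₂ ∈ U, z₁ ≠ z₂ ∧ f z₁ = w ∧ f z₂ = w := by
  obtain ⟨x, hx, hlim⟩ := mem_closure_iff_seq_limit.1 hcl
  choose _ u hu v hv huv hfu hfv using hx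
  have mem_U : ∀ z ∈ E, f z = w → z ∈ U := fun z hz hfz => by
    by_contra h
    exact hw (hfz ▸ hre z hz h)
  obtain ⟨a, ha, hfa, φ, hφ, hua⟩ := exists_subseq_tendsto_of_tendsto_comp hE hcont hinf
    (fun n => hUE (hu n)) (w := w) (by simpa only [hfu] using hlim)
  obtain ⟨b, hb, hfb, ψ, hψ, hvb⟩ := exists_subseq_tendsto_of_tendsto_comp hE hcont hinf
    (u := v ∘ φ) (fun n => hUE (hv _)) (w := w)
    (by simp only [Function.comp_apply, hfv]; exact hlim.comp hφ.tendsto_atTop)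
  refine ⟨a, mem_U a ha hfa, b, mem_U b hb hfb, ?_, hfa, hfb⟩
  rintro rfl
  have haU := mem_U a ha hfa
  have hd : deriv f a ≠ 0 := fun h => hcrit ⟨a, ⟨haU, h⟩, hfa⟩
  have hinv := (hhol.analyticAt (hU.mem_nhds haU)).hasStrictDerivAt.eventually_left_inverse hd
  obtain ⟨n, h₁, h₂⟩ := (((hua.comp hψ.tendsto_atTop).eventually hinv).and
    (hvb.eventually hinv)).exists
  refine huv (φ (ψ n)) ?_
  simp only [Function.comp_apply, hfu, hfv] at h₁ h₂
  exact h₁.symm.trans h₂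

open Topology in
/-- A holomorphic function, asymptotic to a nonconstant affine map and with purely imaginary
boundary values, takes each value with nonzero real part at most once. -/
lemma injective_of_re_ne_zero {f : ℂ → ℂ} {E U : Set ℂ} (hE : IsClosed E)
    (hU : IsOpen U) (hUE : U ⊆ E) (hcont : ContinuousOn f E) (hhol : DifferentiableOn ℂ f U)
    (hUb : Bornology.IsBounded Uᶜ) {α β : ℂ} (hα : α ≠ 0)
    (hasym : Tendsto (fun z => f z - (α * z + β)) (cocompact ℂ) (𝓝 0))
    (hre : ∀ z ∈ E, z ∉ U → (f z).re = 0)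
    (hnc : ∀ z ∈ U, ¬ ∀ᶠ y in 𝓝 z, f y = f z)
    (hopen : ∀ z ∈ U, 𝓝 (f z) ≤ map f (𝓝 z))
    {z₁ z₂ : ℂ} (hz₁ : z₁ ∈ U) (hz₂ : z₂ ∈ U) (heq : f z₁ = f z₂) (hne0 : (f z₁).re ≠ 0) :
    z₁ = z₂ := by
  by_contra hne
  have hinf := tendsto_norm_atTop_of_tendsto_sub_affine hα hasym
  set A := {w : ℂ | w.re ≠ 0 ∧ ∃ z₁ ∈ U, ∃ z₂ ∈ U, z₁ ≠ z₂ ∧ f z₁ = w ∧ f z₂ = w} with hA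
  set C := f '' {z ∈ U | deriv f z = 0} with hC
  have hAo : IsOpen A := isOpen_setOf_double_value hU hopen
  have hCim : (Complex.im '' C).Countable :=
    ((countable_setOf_deriv_eq_zero hU hhol hnc).image f).image _
  have hwA : f z₁ ∈ A := ⟨hne0, z₁, hz₁, z₂, hz₂, hne, rfl, heq.symm⟩
  obtain ⟨w, hwA, hwC⟩ : ∃ w ∈ A, w.im ∉ Complex.im '' C := by
    have hd : Dense (Complex.im ⁻¹' (Complex.im '' C)ᶜ) :=
      (hCim.dense_compl ℝ).preimage Complex.isOpenMap_im
    obtain ⟨w, h₁, h₂⟩ := hd.inter_open_nonempty A hAo ⟨_, hwA⟩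
    exact ⟨w, h₁, h₂⟩
  obtain ⟨M, hM⟩ := exists_injective_of_lt_norm hE hcont hhol hUb hα hasym
  set ray : ℝ → ℂ := fun t => w + (t * w.re : ℝ) with hray
  have hrayc : Continuous ray := by fun_prop
  have hre_ray : ∀ t ∈ Set.Ici (0 : ℝ), (ray t).re ≠ 0 := by
    intro t ht
    have : (ray t).re = (1 + t) * w.re := by simp [hray]; ring
    rw [this]
    have ht' : (0 : ℝ) ≤ t := ht
    exact mul_ne_zero (by positivity) hwA.1
  have hsub : ray '' Set.Ici 0 ⊆ A := by
    refine (isPreconnected_Ici.image ray hrayc.continuousOn).subset_of_closure_inter_subset hAo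
      ⟨w, ⟨0, by simp, by simp [hray]⟩, hwA⟩ ?_
    rintro _ ⟨hcl, t, ht, rfl⟩
    refine ⟨hre_ray t ht, exists_double_value_of_mem_closure hE hU hUE hcont hhol hinf hre
      (hre_ray t ht) hcl fun h => hwC ⟨_, h, by simp [hray]⟩⟩
  have hw0 : 0 < |w.re| := abs_pos.2 hwA.1
  set t : ℝ := |M| / |w.re| with ht
  have ht0 : 0 ≤ t := by positivity
  obtain ⟨-, y₁, hy₁, y₂, hy₂, hy, e₁, e₂⟩ := hsub ⟨t, ht0, rfl⟩
  refine hy (hM y₁ (hUE hy₁) y₂ (hUE hy₂) (e₁.trans e₂.symm) ?_)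
  rw [e₁]
  have h1 : (ray t).re = (1 + t) * w.re := by simp [hray]; ring
  have h2 := Complex.abs_re_le_norm (ray t)
  rw [h1, abs_mul, abs_of_nonneg (by positivity), add_mul, ht, div_mul_cancel₀ _ hw0.ne'] at h2
  linarith [le_abs_self M]

open Topology in
/-- A holomorphic function, asymptotic to a nonconstant affine map and with purely imaginary
boundary values, takes every value with nonzero real part. -/
lemma exists_eq_of_re_ne_zero {f : ℂ → ℂ} {E U : Set ℂ} (hE : IsClosed E)
    (hU : IsOpen U) (hUE : U ⊆ E) (hcont : ContinuousOn f E)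
    (hUb : Bornology.IsBounded Uᶜ) {α β : ℂ} (hα : α ≠ 0)
    (hasym : Tendsto (fun z => f z - (α * z + β)) (cocompact ℂ) (𝓝 0))
    (hre : ∀ z ∈ E, z ∉ U → (f z).re = 0)
    (hopen : ∀ z ∈ U, 𝓝 (f z) ≤ map f (𝓝 z)) {w : ℂ} (hw : w.re ≠ 0) : w ∈ f '' U := by
  have hinf := tendsto_norm_atTop_of_tendsto_sub_affine hα hasym
  have hfU : IsOpen (f '' U) := by
    rw [isOpen_iff_mem_nhds]
    rintro _ ⟨z, hz, rfl⟩
    exact hopen z hz (image_mem_map (hU.mem_nhds hz))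
  have hfE := isClosed_image_of_tendsto_norm_atTop hE hcont hinf
  set H : Set ℂ := {v | 0 < (v * (w.re : ℂ)).re} with hH
  have hHc : Convex ℝ H :=
    convex_halfSpace_gt (f := fun v : ℂ => (v * (w.re : ℂ)).re)
      ⟨fun x y => by simp; ring, fun c x => by simp; ring⟩ 0
  have hHre : ∀ v ∈ H, v.re ≠ 0 := by
    intro v hv h0
    simp [hH, h0] at hv
  suffices h : H ⊆ f '' U from h (by simpa [hH] using mul_self_pos.2 hw)
  refine hHc.isPreconnected.subset_of_closure_inter_subset hfU ?_ ?_
  · set l : ℝ → ℂ := fun r => (r * w.re - β) / α with hl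
    have hlinf : Tendsto l atTop (cocompact ℂ) := by
      rw [← Metric.cobounded_eq_cocompact, ← tendsto_norm_atTop_iff_cobounded]
      have h1 : Tendsto (fun r : ℝ => r * |w.re| + -‖β‖) atTop atTop :=
        tendsto_atTop_add_const_right _ _ (tendsto_id.atTop_mul_const (abs_pos.2 hw))
      refine tendsto_atTop_mono' _ ?_ (h1.atTop_div_const (norm_pos_iff.2 hα))
      filter_upwards [eventually_ge_atTop 0] with r hr
      rw [hl, norm_div]
      gcongr
      have := norm_sub_norm_le ((r : ℂ) * w.re) β
      rw [norm_mul, Complex.norm_of_nonneg hr, Complex.norm_real, Real.norm_eq_abs] at this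
      linarith
    have hev : ∀ᶠ z in cocompact ℂ, ‖f z - (α * z + β)‖ < |w.re| ∧ z ∈ U := by
      refine (hasym.norm.eventually (gt_mem_nhds (by simpa using hw))).and ?_
      rw [← Metric.cobounded_eq_cocompact]
      simpa using Bornology.isBounded_def.1 hUb
    obtain ⟨r, ⟨h₁, h₂⟩, hr⟩ :=
      ((hlinf.eventually hev).and (eventually_ge_atTop (1 : ℝ))).exists
    refine ⟨f (l r), ?_, l r, h₂, rfl⟩
    have e : α * l r + β = r * w.re := by
      simp only [hl]
      field_simp
      ring
    rw [e] at h₁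
    have h₃ := (Complex.abs_re_le_norm _).trans_lt h₁
    simp only [Complex.sub_re, Complex.mul_re, Complex.ofReal_re, Complex.ofReal_im, mul_zero,
      sub_zero] at h₃
    have h₄ := sq_lt_sq.2 h₃
    simp only [hH, Set.mem_ofPred_eq, Complex.mul_re, Complex.ofReal_re, Complex.ofReal_im,
      mul_zero, sub_zero]
    by_contra! hle
    nlinarith [sq_nonneg (f (l r)).re, mul_self_pos.2 hw, sq_nonneg ((r - 1) * w.re),
      mul_nonneg (sub_nonneg.2 hr) (mul_self_pos.2 hw).le,
      mul_nonneg (show 0 ≤ r by linarith) (neg_nonneg.2 hle)]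
  · rintro v ⟨hv, hvH⟩
    obtain ⟨z, hz, rfl⟩ := closure_minimal (Set.image_mono hUE) hfE hv
    refine ⟨z, ?_, rfl⟩
    by_contra hzU
    exact hHre _ hvH (hre z hz hzU)

/-- Every horizontal level between the extreme levels of the boundary of a bounded connected open
set is attained at a boundary point accessible from the exterior. -/
lemma exists_mem_frontier_mem_closure_im_eq {Ω : Set ℂ} (hbd : Bornology.IsBounded Ω)
    (hop : IsOpen Ω) (hconn : IsConnected Ω) {t : ℝ}
    (ht : t ∈ Set.Icc (sInf (Complex.im '' frontier Ω)) (sSup (Complex.im '' frontier Ω))) :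
    ∃ p ∈ frontier Ω, p ∈ closure (closure Ω)ᶜ ∧ p.im = t := by
  have hK : IsCompact (closure Ω) := hbd.isCompact_closure
  have hF : IsCompact (frontier Ω) := hK.of_isClosed_subset isClosed_frontier
    frontier_subset_closure
  have hFne : (frontier Ω).Nonempty := by
    obtain ⟨z, hz⟩ := hconn.nonempty
    obtain ⟨p, hp, hpΩ, -⟩ := exists_mem_closure_diff_lt_mul_im hop hbd hz one_ne_zero
    exact ⟨p, by rw [hop.frontier_eq]; exact ⟨hp, hpΩ⟩⟩
  have hFim := hF.image Complex.continuous_im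
  obtain ⟨a, ha, hat⟩ := hFim.sInf_mem (hFne.image _)
  obtain ⟨b, hb, hbt⟩ := hFim.sSup_mem (hFne.image _)
  rw [← hat, ← hbt] at ht
  obtain ⟨q, hq, hqt⟩ := hconn.closure.isPreconnected.intermediate_value
    (frontier_subset_closure ha) (frontier_subset_closure hb)
    Complex.continuous_im.continuousOn ht
  obtain ⟨p, ⟨hp, hpt⟩, hmax⟩ :=
    (hK.inter_right (isClosed_singleton.preimage Complex.continuous_im)).exists_isMaxOn
      ⟨q, hq, hqt⟩ Complex.continuous_re.continuousOn
  have hpt : p.im = t := hpt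
  have hpc : p ∈ closure (closure Ω)ᶜ := by
    have hc : Tendsto (fun s : ℝ => p + (s : ℂ)) (nhdsWithin 0 (Set.Ioi 0)) (nhds p) := by
      have h : Continuous (fun s : ℝ => p + (s : ℂ)) := by fun_prop
      have h := h.tendsto 0
      simp only [Complex.ofReal_zero, add_zero] at h
      exact h.mono_left nhdsWithin_le_nhds
    refine mem_closure_of_tendsto hc ?_
    filter_upwards [self_mem_nhdsWithin] with s hs hmem
    have h := hmax (show p + (s : ℂ) ∈ _ from ⟨hmem, by simp [hpt]⟩)
    have hs : 0 < s := hs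
    simp at h
    linarith
  refine ⟨p, ?_, hpc, hpt⟩
  rw [frontier_eq_closure_inter_closure]
  exact ⟨hp, closure_mono (Set.compl_subset_compl.2 subset_closure) hpc⟩

/-- The exterior map `f` (continuous on `ℂ ∖ Ω`, holomorphic outside `closure Ω`,
`f(z) ~ αz + β` at infinity with `α ≠ 0`, and `f = i·Im` on `∂Ω`) maps `ℂ ∖ closure Ω`
onto the complement of the vertical slit `{i·t : c₁ ≤ t ≤ c₂}`, where `c₁` and `c₂` are
the infimum and supremum of `Im` on `∂Ω`. -/
theorem exterior_map_image (Ω : Set ℂ) (hne : Ω.Nonempty)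
    (hbd : Bornology.IsBounded Ω) (hop : IsOpen Ω) (hsc : SimplyConnectedSpace Ω)
    (f : ℂ → ℂ) (hcont : ContinuousOn f Ωᶜ) (hhol : DifferentiableOn ℂ f (closure Ω)ᶜ)
    (α β : ℂ) (hα : α ≠ 0)
    (hasym : Tendsto (fun z => f z - (α * z + β)) (cocompact ℂ) (nhds 0))
    (hbdry : ∀ z ∈ frontier Ω, f z = Complex.I * (z.im : ℂ))
    (c₁ c₂ : ℝ) (hc₁ : c₁ = sInf (Complex.im '' frontier Ω))
    (hc₂ : c₂ = sSup (Complex.im '' frontier Ω)) :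
    f '' (closure Ω)ᶜ = ((fun t : ℝ => Complex.I * (t : ℂ)) '' Set.Icc c₁ c₂)ᶜ := by
  have hE : IsClosed Ωᶜ := hop.isClosed_compl
  have hU : IsOpen (closure Ω)ᶜ := isClosed_closure.isOpen_compl
  have hUE : (closure Ω)ᶜ ⊆ Ωᶜ := Set.compl_subset_compl.2 subset_closure
  have hUb : Bornology.IsBounded ((closure Ω)ᶜ)ᶜ := by rw [compl_compl]; exact hbd.closure
  have hinf := tendsto_norm_atTop_of_tendsto_sub_affine hα hasym
  have hfr : ∀ z ∈ Ωᶜ, z ∉ (closure Ω)ᶜ → z ∈ frontier Ω := fun z hz hzU => by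
    rw [hop.frontier_eq]
    exact ⟨not_not.1 hzU, hz⟩
  have hre : ∀ z ∈ Ωᶜ, z ∉ (closure Ω)ᶜ → (f z).re = 0 := fun z hz hzU => by
    simp [hbdry z (hfr z hz hzU)]
  have him : ∀ z ∈ Ωᶜ, z ∉ (closure Ω)ᶜ → (f z).im = z.im := fun z hz hzU => by
    simp [hbdry z (hfr z hz hzU)]
  have hnc : ∀ z ∈ (closure Ω)ᶜ, ¬ ∀ᶠ y in nhds z, f y = f z := fun z hz =>
    not_eventually_const_of_im_eq hE hU hUE hcont hhol hinf him hz
  have hopen : ∀ z ∈ (closure Ω)ᶜ, nhds (f z) ≤ map f (nhds z) := fun z hz =>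
    (hhol.analyticAt (hU.mem_nhds hz)).eventually_constant_or_nhds_le_map_nhds.resolve_left
      (hnc z hz)
  have hconn : IsConnected Ω := isConnected_iff_connectedSpace.2 inferInstance
  have hdense : Dense {w : ℂ | w.re ≠ 0} :=
    (dense_compl_singleton (0 : ℝ)).preimage Complex.isOpenMap_re
  apply Set.Subset.antisymm
  · rintro _ ⟨z, hz, rfl⟩ ⟨t, ht, hzt⟩
    have hzt : Complex.I * (t : ℂ) = f z := hzt
    rw [hc₁, hc₂] at ht
    obtain ⟨p, hpF, hpc, hpt⟩ := exists_mem_frontier_mem_closure_im_eq hbd hop hconn ht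
    have hpΩ : p ∈ Ωᶜ := by
      rw [hop.frontier_eq] at hpF
      exact hpF.2
    have hfp : f p = f z := by rw [hbdry p hpF, hpt, hzt]
    have hpz : p ≠ z := by
      rintro rfl
      exact hz (frontier_subset_closure hpF)
    obtain ⟨N₁, hN₁, N₂, hN₂, hdisj⟩ := Filter.disjoint_iff.1 (disjoint_nhds_nhds.2 hpz)
    have hnear : f '' (N₂ ∩ (closure Ω)ᶜ) ∈ nhds (f p) :=
      hfp ▸ hopen z hz (image_mem_map (inter_mem hN₂ (hU.mem_nhds hz)))
    have hpre : ∀ᶠ y in nhdsWithin p (closure Ω)ᶜ, interior (f '' (N₂ ∩ (closure Ω)ᶜ)) ∈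
        nhds (f y) :=
      ((hcont p hpΩ).mono hUE).eventually
        (isOpen_interior.eventually_mem (mem_interior_iff_mem_nhds.2 hnear)) |>.mono
        fun y hy => isOpen_interior.mem_nhds hy
    have : (nhdsWithin p (closure Ω)ᶜ).NeBot := mem_closure_iff_nhdsWithin_neBot.1 hpc
    obtain ⟨y, ⟨hy, hyN⟩, hyU⟩ := ((hpre.and
      (nhdsWithin_le_nhds (interior_mem_nhds.2 hN₁))).and self_mem_nhdsWithin).exists
    have hyim : f '' (interior N₁ ∩ (closure Ω)ᶜ) ∈ nhds (f y) :=
      hopen y hyU (image_mem_map ((isOpen_interior.inter hU).mem_nhds ⟨hyN, hyU⟩))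
    obtain ⟨w, hwre, hwN, z₁, ⟨hz₁N, hz₁U⟩, rfl⟩ :=
      hdense.inter_nhds_nonempty (inter_mem hy hyim)
    obtain ⟨z₂, ⟨hz₂N, hz₂U⟩, heq⟩ := interior_subset hwN
    have h₁₂ := injective_of_re_ne_zero hE hU hUE hcont hhol hUb hα hasym hre hnc hopen
      hz₁U hz₂U heq.symm hwre
    exact Set.disjoint_left.1 hdisj (interior_subset hz₁N) (h₁₂ ▸ hz₂N)
  · intro w hw
    have hfE := isClosed_image_of_tendsto_norm_atTop hE hcont hinf
    have hall : w ∈ f '' Ωᶜ := by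
      refine hfE.closure_subset_iff.2 (fun v hv => ?_) (hdense w)
      exact Set.image_mono hUE
        (exists_eq_of_re_ne_zero hE hU hUE hcont hUb hα hasym hre hopen hv)
    obtain ⟨z, hz, rfl⟩ := hall
    refine ⟨z, ?_, rfl⟩
    by_contra hzU
    have hzF := hfr z hz hzU
    have hFim : IsCompact (Complex.im '' frontier Ω) :=
      (hbd.isCompact_closure.of_isClosed_subset isClosed_frontier
        frontier_subset_closure).image Complex.continuous_im
    refine hw ⟨z.im, ⟨?_, ?_⟩, (hbdry z hzF).symm⟩
    · exact hc₁ ▸ csInf_le hFim.bddBelow ⟨z, hzF, rfl⟩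
    · exact hc₂ ▸ le_csSup hFim.bddAbove ⟨z, hzF, rfl⟩
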